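/- There exist connected graphs of arbitrarily large order with maximum degree 3 whose zero forcing number exceeds (1/3)·n + 2, where n is the order; in particular the conjecture of Gentner and Rautenbach that Z(G) ≤ n/3 + 2 for all connected graphs G of maximum degree 3 is false. Formally: for every N there exists a connected graph G with maximum degree 3, |V(G)| ≥ N, and Z(G) ≥ (4/9)·|V(G)|. -/

import Mathlib

/-- The zero forcing closure: vertices that eventually become black when the
vertices of `S` are initially black and we repeatedly apply the rule that a
white vertex `u` becomes black if it is the unique white neighbor of some black
vertex `v` (we say `v` forces `u`). -/
inductive ZFClosure {V : Type*} (G : SimpleGraph V) (S : Set V) : V → Prop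
  | init (v : V) : v ∈ S → ZFClosure G S v
  | force (u v : V) : G.Adj v u → ZFClosure G S v →
      (∀ w, G.Adj v w → w ≠ u → ZFClosure G S w) → ZFClosure G S u

/-- `S` is a zero forcing set of `G` if every vertex eventually becomes black. -/
def IsZeroForcingSet {V : Type*} (G : SimpleGraph V) (S : Set V) : Prop :=
  ∀ v, ZFClosure G S v

/-- The zero forcing number `Z(G)`: the minimum cardinality of a zero forcing set. -/
noncomputable def zeroForcingNumber {V : Type*} (G : SimpleGraph V) : ℕ :=
  sInf {k | ∃ S : Set V, S.ncard = k ∧ IsZeroForcingSet G S}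

/-- Adjacency inside one block (labels `0,1,2` and `3,4,5` are the sides of a `K_{3,3}` whose
edge `03` is subdivided by `6`; `7` and `8` are the spine vertices of the block). -/
def blockAdj (k l : Fin 9) : Bool :=
  (k, l) ∈ ([(0,4),(0,5),(1,3),(1,4),(1,5),(2,3),(2,4),(2,5),(0,6),(3,6),(6,7),(7,8)] :
    List (Fin 9 × Fin 9))

/-- A directed version of the adjacency of the whole graph. -/
def preAdj (m : ℕ) (v w : Fin m × Fin 9) : Prop :=
  (v.1 = w.1 ∧ blockAdj v.2 w.2 = true) ∨ (v.1.val + 1 = w.1.val ∧ v.2 = 8 ∧ w.2 = 7)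

/-- The graph. -/
def theGraph (m : ℕ) : SimpleGraph (Fin m × Fin 9) where
  Adj v w := preAdj m v w ∨ preAdj m w v
  symm := ⟨fun _ _ h => h.symm⟩
  loopless := ⟨by
    rintro ⟨i, k⟩ h
    have h' : preAdj m (i, k) (i, k) := h.elim id id
    clear h
    rcases h' with ⟨-, h⟩ | ⟨h, -⟩
    · have : ∀ k, ¬ (blockAdj k k = true) := by decide
      exact this k h
    · simp at h⟩

/-- Value of the spine parameter at the previous block. -/
def prevVal {m : ℕ} (p : Fin m → ZMod 2) (i : Fin m) : ZMod 2 :=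
  if i.val = 0 then 0 else p ⟨i.val - 1, by omega⟩

/-- The kernel vector attached to parameters. -/
def kvec {m : ℕ} (P : Fin 4 → Fin m → ZMod 2) (v : Fin m × Fin 9) : ZMod 2 :=
  let i := v.1
  let s := P 0 i + prevVal (P 0) i
  ![P 1 i, P 2 i, P 1 i + P 2 i, s + P 1 i, P 3 i, s + P 1 i + P 3 i, s, 0, P 0 i] v.2

theorem kvec_sub {m : ℕ} (P Q : Fin 4 → Fin m → ZMod 2) (v : Fin m × Fin 9) :
    kvec (P - Q) v = kvec P v - kvec Q v := by
  obtain ⟨i, k⟩ := v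
  have : prevVal (P 0 - Q 0) i = prevVal (P 0) i - prevVal (Q 0) i := by
    unfold prevVal; split_ifs <;> simp
  fin_cases k <;> simp [kvec, this] <;> ring

/-- The values of the kernel vector on one block. -/
def blockVal (p q a c b : ZMod 2) : Fin 9 → ZMod 2 :=
  ![a, c, a + c, p + q + a, b, p + q + a + b, p + q, 0, p]

theorem blockVal_fort : ∀ (k l : Fin 9) (p q a c b : ZMod 2),
    (blockAdj k l = true ∨ blockAdj l k = true) → (k = 7 → q = 0) →
    blockVal p q a c b k = 0 →
    (∀ l', (blockAdj k l' = true ∨ blockAdj l' k = true) → l' ≠ l → blockVal p q a c b l' = 0) →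
    blockVal p q a c b l = 0 := by
  decide +kernel

theorem kvec_fort {m : ℕ} (P : Fin 4 → Fin m → ZMod 2) (v u : Fin m × Fin 9)
    (huv : (theGraph m).Adj v u) (hv : kvec P v = 0)
    (hw : ∀ w, (theGraph m).Adj v w → w ≠ u → kvec P w = 0) : kvec P u = 0 := by
  obtain ⟨i, k⟩ := v
  obtain ⟨j, l⟩ := u
  have key : ∀ l', (blockAdj k l' = true ∨ blockAdj l' k = true) → (i, l') ≠ (j, l) →
      kvec P (i, l') = 0 := by
    intro l' h hne
    apply hw _ _ hne
    rcases h with h | h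
    · exact Or.inl (Or.inl ⟨rfl, h⟩)
    · exact Or.inr (Or.inl ⟨rfl, h⟩)
  have main : i = j → (blockAdj k l = true ∨ blockAdj l k = true) → kvec P (j, l) = 0 := by
    intro hij hkl
    subst hij
    refine blockVal_fort k l (P 0 i) (prevVal (P 0) i) (P 1 i) (P 2 i) (P 3 i) hkl ?_ hv ?_
    · intro hk
      unfold prevVal
      split_ifs with h0
      · rfl
      · refine hw (⟨i.val - 1, by omega⟩, 8) (Or.inr (Or.inr ⟨?_, rfl, hk⟩)) ?_
        · simp only; omega
        · intro he
          have := congrArg (fun x => x.1.val) he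
          simp only at this
          omega
    · intro l' h hne
      exact key l' h (by simpa using hne)
  rcases huv with (⟨h1, h2⟩ | ⟨h1, h2, h3⟩) | (⟨h1, h2⟩ | ⟨h1, h2, h3⟩)
  · exact main h1 (Or.inl h2)
  · simp only at h2 h3
    subst h3; simp [kvec]
  · exact main h1.symm (Or.inr h2)
  · simp only at h1 h2 h3
    subst h2 h3
    have h6 := key 6 (by decide) (by simp)
    have h8 := key 8 (by decide) (by simp; omega)
    have hp : prevVal (P 0) i = P 0 j := by
      unfold prevVal
      rw [if_neg (by omega)]
      congr 1; ext; simp; omega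
    simp [kvec, hp] at h6 h8 ⊢
    simpa [h8] using h6

theorem nbr_bound (m : ℕ) (v : Fin m × Fin 9) : ((theGraph m).neighborSet v).ncard ≤ 3 := by
  have hS : ∃ p q r, (theGraph m).neighborSet v ⊆ {p, q, r} := by
    obtain ⟨i, k⟩ := v
    let pr : Fin m := ⟨i.val - 1, by omega⟩
    let sc : Fin m := if h : i.val + 1 < m then ⟨i.val + 1, h⟩ else i
    have gen : ∀ a b c : Fin m × Fin 9,
        (∀ l, (blockAdj k l = true ∨ blockAdj l k = true) → (i, l) = a ∨ (i, l) = b ∨ (i, l) = c) →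
        (k = 8 → (sc, 7) = a ∨ (sc, 7) = b ∨ (sc, 7) = c) →
        (k = 7 → (pr, 8) = a ∨ (pr, 8) = b ∨ (pr, 8) = c) →
        ∃ p q r, (theGraph m).neighborSet (i, k) ⊆ {p, q, r} := by
      intro a b c h1 h2 h3
      refine ⟨a, b, c, ?_⟩
      rintro ⟨j, l⟩ hjl
      simp only [Set.mem_insert_iff, Set.mem_singleton_iff]
      rcases hjl with (⟨e1, e2⟩ | ⟨e1, e2, e3⟩) | (⟨e1, e2⟩ | ⟨e1, e2, e3⟩) <;> simp only at e1 e2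
      · subst e1; exact h1 l (Or.inl e2)
      · simp only at e3
        have : sc = j := by
          ext; simp only [sc]; rw [dif_pos (by omega)]; exact e1
        rw [e3, ← this]; exact h2 e2
      · subst e1; exact h1 l (Or.inr e2)
      · simp only at e3
        have : pr = j := by
          ext; simp only [pr]; omega
        rw [e2, ← this]; exact h3 e3
    have fin : ∀ k : Fin 9, k ≠ 7 → k ≠ 8 → ∃ a b c : Fin 9,
        ∀ l, (blockAdj k l = true ∨ blockAdj l k = true) → l = a ∨ l = b ∨ l = c := by decide
    by_cases h7 : k = 7
    · subst h7
      apply gen (i, 6) (i, 8) (pr, 8)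
      · simp only [Prod.mk.injEq, true_and]
        have : ∀ l : Fin 9, blockAdj 7 l = true ∨ blockAdj l 7 = true → l = 6 ∨ l = 8 := by decide
        intro l hl
        have := this l hl
        tauto
      · intro h; exact absurd h (by decide)
      · simp
    by_cases h8 : k = 8
    · subst h8
      apply gen (i, 7) (sc, 7) (sc, 7)
      · simp only [Prod.mk.injEq, true_and]
        have : ∀ l : Fin 9, blockAdj 8 l = true ∨ blockAdj l 8 = true → l = 7 := by decide
        intro l hl
        have := this l hl
        tauto
      · simp
      · intro h; exact absurd h (by decide)
    obtain ⟨a, b, c, h⟩ := fin k h7 h8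
    apply gen (i, a) (i, b) (i, c)
    · simpa using h
    · intro h; exact absurd h h8
    · intro h; exact absurd h h7
  obtain ⟨p, q, r, h⟩ := hS
  refine (Set.ncard_le_ncard h).trans ?_
  refine (Set.ncard_insert_le _ _).trans ?_
  have := Set.ncard_insert_le q {r}
  rw [Set.ncard_singleton] at this
  omega

theorem graph_connected (m : ℕ) : (theGraph (m + 1)).Connected := by
  have loc : ∀ (i : Fin (m + 1)) (k l : Fin 9), blockAdj k l = true →
      (theGraph (m + 1)).Reachable (i, k) (i, l) := fun i k l h =>
    SimpleGraph.Adj.reachable (Or.inl (Or.inl ⟨rfl, h⟩))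
  have blk : ∀ (i : Fin (m + 1)) (k : Fin 9), (theGraph (m + 1)).Reachable (i, 7) (i, k) := by
    intro i k
    have r6 := (loc i 6 7 (by decide)).symm
    have r0 := r6.trans (loc i 0 6 (by decide)).symm
    have r3 := r6.trans (loc i 3 6 (by decide)).symm
    have r8 := loc i 7 8 (by decide)
    have r4 := r0.trans (loc i 0 4 (by decide))
    have r5 := r0.trans (loc i 0 5 (by decide))
    have r1 := r3.trans (loc i 1 3 (by decide)).symm
    have r2 := r3.trans (loc i 2 3 (by decide)).symm
    fin_cases k
    exacts [r0, r1, r2, r3, r4, r5, r6, SimpleGraph.Reachable.refl _, r8]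
  have spine : ∀ (n : ℕ) (h : n < m + 1),
      (theGraph (m + 1)).Reachable (0, 7) (⟨n, h⟩, 7) := by
    intro n
    induction n with
    | zero => intro h; exact SimpleGraph.Reachable.refl _
    | succ n ih =>
      intro h
      refine ((ih (by omega)).trans (blk _ 8)).trans (SimpleGraph.Adj.reachable ?_)
      exact Or.inl (Or.inr ⟨rfl, rfl, rfl⟩)
  have all : ∀ v, (theGraph (m + 1)).Reachable (0, 7) v := fun v =>
    (spine v.1.val v.1.isLt).trans (blk v.1 v.2)
  exact { preconnected := fun v w => (all v).symm.trans (all w), nonempty := ⟨(0, 7)⟩ }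

theorem zf_lower (m : ℕ) (S : Set (Fin m × Fin 9)) (hS : IsZeroForcingSet (theGraph m) S) :
    4 * m ≤ S.ncard := by
  classical
  have inj : Function.Injective
      (fun (P : Fin 4 → Fin m → ZMod 2) (v : S) => kvec P v.1) := by
    intro P Q h
    have hz : ∀ v, kvec (P - Q) v = 0 := by
      intro v
      induction hS v with
      | init v hv =>
        rw [kvec_sub, sub_eq_zero]
        exact congrFun h ⟨v, hv⟩
      | force u v huv _ _ ih1 ih2 => exact kvec_fort _ v u huv ih1 ih2
    rw [← sub_eq_zero]
    funext a i
    have h0 := hz (i, 8)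
    have h1 := hz (i, 0)
    have h2 := hz (i, 1)
    have h3 := hz (i, 4)
    fin_cases a
    exacts [h0, h1, h2, h3]
  have hc := Fintype.card_le_of_injective _ inj
  simp only [Fintype.card_fun, ZMod.card, Fintype.card_fin, ← pow_mul] at hc
  have := (Nat.pow_le_pow_iff_right (by norm_num : 1 < 2)).1 hc
  rw [← Nat.card_coe_set_eq, Nat.card_eq_fintype_card]
  omega

/-- Disproof of the conjecture of Gentner and Rautenbach: for every `N` there is a
connected graph `G` with maximum degree `3` and at least `N` vertices such that
`Z(G) ≥ (4/9)|V(G)|` (in particular `Z(G) > |V(G)|/3 + 2` for large `N`). -/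
theorem exists_counterexample (N : ℕ) :
    ∃ (V : Type) (_ : Fintype V) (G : SimpleGraph V),
      G.Connected ∧ (∀ v, (G.neighborSet v).ncard ≤ 3) ∧ N ≤ Nat.card V ∧
      (4 / 9 : ℚ) * Nat.card V ≤ zeroForcingNumber G := by
  refine ⟨Fin (N + 1) × Fin 9, inferInstance, theGraph (N + 1), graph_connected N,
    nbr_bound _, ?_, ?_⟩
  · simp; omega
  · have h : 4 * (N + 1) ≤ zeroForcingNumber (theGraph (N + 1)) := by
      unfold zeroForcingNumber
      apply le_csInf
      · exact ⟨_, Set.univ, rfl, fun v => ZFClosure.init v trivial⟩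
      · rintro k ⟨S, rfl, hS⟩
        exact zf_lower _ S hS
    have h' : ((4 * (N + 1) : ℕ) : ℚ) ≤ zeroForcingNumber (theGraph (N + 1)) := by
      exact_mod_cast h
    simp only [Nat.card_eq_fintype_card, Fintype.card_prod, Fintype.card_fin]
    push_cast at h' ⊢
    linarith
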